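/- Let G be a group and suppose FC(G) = {g ∈ G : |G : C_G(g)| ≤ k} for some fixed natural number k (i.e., every element with finite conjugacy class has conjugacy class of size at most k). Then the commutator subgroup [FC(G), FC(G)] is finite; that is, FC(G) is finite-by-abelian. -/

import Mathlib

theorem bfc_commutatorSet_finite (F : Type*) [Group F] (k : ℕ)
    (hfin : ∀ g : F, {x : F | IsConj g x}.Finite)
    (hk : ∀ g : F, {x : F | IsConj g x}.ncard ≤ k) : (commutatorSet F).Finite := by
  classical
  -- an element with a class of maximal size
  obtain ⟨a, ha⟩ : ∃ a : F, ∀ g : F,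
      {x : F | IsConj g x}.ncard ≤ {x : F | IsConj a x}.ncard := by
    have hb : (Set.range fun g : F => {x : F | IsConj g x}.ncard).Finite :=
      (Set.finite_Iic k).subset (by rintro _ ⟨g, rfl⟩; exact hk g)
    obtain ⟨m, ⟨a, rfl⟩, hm⟩ := Set.exists_max_image _ id hb (Set.range_nonempty _)
    exact ⟨a, fun g => hm _ ⟨g, rfl⟩⟩
  set A : Set F := {x : F | IsConj a x} with hA
  have hb : ∀ y : A, ∃ b : F, b * a * b⁻¹ = y := fun y => isConj_iff.1 y.2
  choose b hb using hb
  have : Finite A := (hfin a).to_subtype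
  -- commutators with elements commuting with all `b y`
  have key : ∀ c : F, (∀ y, c * b y * c⁻¹ = b y) → ∀ x : F,
      x * c * x⁻¹ * c⁻¹ ∈ Set.image2 (fun u v => u⁻¹ * v) A A := by
    intro c hc x
    have hsub : (fun y => y * c) '' A ⊆ {x : F | IsConj (a * c) x} := by
      rintro _ ⟨y, hy, rfl⟩
      refine isConj_iff.2 ⟨b ⟨y, hy⟩, ?_⟩
      have h1 := hb ⟨y, hy⟩
      have h2 : c * (b ⟨y, hy⟩)⁻¹ = (b ⟨y, hy⟩)⁻¹ * c := by
        have := mul_inv_eq_iff_eq_mul.1 (hc ⟨y, hy⟩)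
        have h3 : Commute c (b ⟨y, hy⟩) := this
        exact h3.inv_right
      calc _ = b ⟨y, hy⟩ * a * (c * (b ⟨y, hy⟩)⁻¹) := by group
        _ = b ⟨y, hy⟩ * a * (b ⟨y, hy⟩)⁻¹ * c := by rw [h2]; group
        _ = _ := by rw [h1]
    have heq := Set.eq_of_subset_of_ncard_le hsub (by
      rw [Set.ncard_image_of_injective _ (mul_left_injective c)]
      exact ha _) (hfin _)
    have hx : x * (a * c) * x⁻¹ ∈ {x : F | IsConj (a * c) x} := isConj_iff.2 ⟨x, rfl⟩
    rw [← heq] at hx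
    obtain ⟨y, hy, hyx⟩ := hx
    refine ⟨x * a * x⁻¹, isConj_iff.2 ⟨x, rfl⟩, y, hy, ?_⟩
    have : y = x * (a * c) * x⁻¹ * c⁻¹ := by rw [← hyx]; group
    simp only [this]; group
  have hφ : (Set.range fun (f : F) (y : A) => f * b y * f⁻¹).Finite := by
    refine (Set.Finite.pi (t := fun y : A => {x : F | IsConj (b y) x})
      (fun y => hfin _)).subset ?_
    rintro _ ⟨f, rfl⟩ y -
    exact isConj_iff.2 ⟨f, rfl⟩
  obtain ⟨T, -, hT, hTim⟩ : ∃ T ⊆ (Set.univ : Set F), T.Finite ∧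
      (fun (f : F) (y : A) => f * b y * f⁻¹) '' T = 
        Set.range fun (f : F) (y : A) => f * b y * f⁻¹ := by
    rw [← Set.image_univ] at hφ ⊢
    obtain ⟨T, h1, h2⟩ := Set.exists_subset_bijOn Set.univ
      (fun (f : F) (y : A) => f * b y * f⁻¹)
    exact ⟨T, h1, Set.Finite.of_finite_image (h2.image_eq ▸ hφ) h2.injOn, h2.image_eq⟩
  have hbig : (⋃ t ∈ T, Set.image2 (fun s τ => s * τ * t⁻¹) {x : F | IsConj t x}
      (Set.image2 (fun u v => u⁻¹ * v) A A)).Finite :=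
    hT.biUnion fun t _ => (hfin t).image2 _ ((hfin a).image2 _ (hfin a))
  refine hbig.subset ?_
  rintro _ ⟨x, f, rfl⟩
  obtain ⟨t, ht, htf⟩ := hTim.symm ▸ Set.mem_range_self (f := fun (f : F) (y : A) => f * b y * f⁻¹) f
  refine Set.mem_biUnion ht ⟨x * t * x⁻¹, isConj_iff.2 ⟨x, rfl⟩, _,
    key (t⁻¹ * f) (fun y => ?_) x, ?_⟩
  · have h1 : t * b y * t⁻¹ = f * b y * f⁻¹ := congrFun htf y
    calc _ = t⁻¹ * (f * b y * f⁻¹) * t := by group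
      _ = _ := by rw [← h1]; group
  · simp only [commutatorElement_def]; group

/-- The FC-center as a subgroup. -/
def fcSubgroup (G : Type*) [Group G] : Subgroup G where
  carrier := {g | {x : G | IsConj g x}.Finite}
  one_mem' := by
    refine (Set.finite_singleton (1 : G)).subset ?_
    intro x hx
    exact isConj_one_right.1 hx
  mul_mem' := by
    intro a b ha hb
    refine (Set.Finite.image2 (fun u v => u * v) ha hb).subset ?_
    intro x hx
    obtain ⟨c, rfl⟩ := isConj_iff.1 hx
    exact ⟨c * a * c⁻¹, isConj_iff.2 ⟨c, rfl⟩, c * b * c⁻¹, isConj_iff.2 ⟨c, rfl⟩, by group⟩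
  inv_mem' := by
    intro a ha
    refine (Set.Finite.image (fun u => u⁻¹) ha).subset ?_
    intro x hx
    obtain ⟨c, rfl⟩ := isConj_iff.1 hx
    exact ⟨c * a * c⁻¹, isConj_iff.2 ⟨c, rfl⟩, by group⟩

theorem ncard_isConj_eq_index (G : Type*) [Group G] (g : G) :
    {x : G | IsConj g x}.ncard = (Subgroup.centralizer {g}).index := by
  have h1 := MulAction.index_stabilizer (ConjAct G) g
  rw [ConjAct.stabilizer_eq_centralizer] at h1
  have h2 : MulAction.orbit (ConjAct G) g = {x : G | IsConj g x} := by
    ext x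
    rw [ConjAct.mem_orbit_conjAct, isConj_comm]; rfl
  rw [h2] at h1
  rw [← h1]
  rfl

/-- B.H. Neumann: if every element of `G` with finite conjugacy class has centralizer of
finite index at most `k`, then the commutator subgroup of the FC-center is finite. -/
theorem fc_center_finite_by_abelian_of_bounded
    (G : Type*) [Group G] (k : ℕ) (hk : 1 ≤ k)
    (h : ∀ g : G, ({x : G | IsConj g x}).Finite →
      (Subgroup.centralizer {g}).index ≠ 0 ∧ (Subgroup.centralizer {g}).index ≤ k) :
    (Subgroup.closure {c : G | ∃ a b : G, ({x : G | IsConj a x}).Finite ∧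
        ({x : G | IsConj b x}).Finite ∧ c = a⁻¹ * b⁻¹ * a * b} : Set G).Finite := by
  have hsub : ∀ g : fcSubgroup G, Subtype.val '' {x : fcSubgroup G | IsConj g x} ⊆
      {x : G | IsConj (g : G) x} := by
    rintro g _ ⟨x, hx, rfl⟩
    exact MonoidHom.map_isConj (fcSubgroup G).subtype hx
  have hfin : (commutatorSet (fcSubgroup G)).Finite := by
    refine bfc_commutatorSet_finite _ k (fun g => ?_) (fun g => ?_)
    · exact Set.Finite.of_finite_image (Set.Finite.subset g.2 (hsub g))
        Subtype.val_injective.injOn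
    · rw [← Set.ncard_image_of_injective _ Subtype.val_injective]
      refine (Set.ncard_le_ncard (hsub g) g.2).trans ?_
      rw [ncard_isConj_eq_index]
      exact (h _ g.2).2
  have : Finite (commutatorSet (fcSubgroup G)) := hfin.to_subtype
  have hc : Finite (commutator (fcSubgroup G)) := inferInstance
  have hm : (((commutator (fcSubgroup G)).map (fcSubgroup G).subtype : Subgroup G) :
      Set G).Finite := by
    rw [Subgroup.coe_map]
    exact Set.Finite.image _ (Set.toFinite _)
  refine hm.subset ?_
  rw [SetLike.coe_subset_coe, Subgroup.closure_le]
  rintro _ ⟨a, b, ha, hb, rfl⟩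
  let a' : fcSubgroup G := ⟨a, ha⟩
  let b' : fcSubgroup G := ⟨b, hb⟩
  refine ⟨_, commutator_eq_closure (fcSubgroup G) ▸
    Subgroup.subset_closure (commutator_mem_commutatorSet a'⁻¹ b'⁻¹), ?_⟩
  simp [commutatorElement_def, a', b']
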